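/- Let μ be a centered Gaussian probability measure on ℝ^n with covariance matrix V, and let a, b, c, d, e, f be (not necessarily distinct) indices in {1, …, n}. Write Ỹ_{ij} = X_i X_j − V_{i,j} for the centered doublets. Then the fourth joint cumulant of the two singlets X_a, X_b and the two doublets X_c X_d, X_e X_f equals the third joint cumulant obtained by replacing the two singlets by the single doublet X_a X_b: E[X_a X_b Ỹ_{cd} Ỹ_{ef}] − E[X_a X_b] E[Ỹ_{cd} Ỹ_{ef}] − E[X_a Ỹ_{cd}] E[X_b Ỹ_{ef}] − E[X_a Ỹ_{ef}] E[X_b Ỹ_{cd}] = E[Ỹ_{ab} Ỹ_{cd} Ỹ_{ef}]. -/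

import Mathlib

open MeasureTheory ProbabilityTheory

/-- A centered Gaussian probability measure on `ℝ^n`: a probability measure whose
pushforward under every continuous linear functional is a real Gaussian measure,
and whose mean vector is zero. -/
def IsCenteredGaussian {n : ℕ} (μ : Measure (EuclideanSpace ℝ (Fin n))) : Prop :=
  IsProbabilityMeasure μ ∧
  (∀ L : EuclideanSpace ℝ (Fin n) →L[ℝ] ℝ,
      ∃ (m : ℝ) (v : NNReal), μ.map L = gaussianReal m v) ∧
  (∫ x, x ∂μ) = 0

open scoped ENNReal

/-- A centered Gaussian measure is invariant under negation. -/
lemma ProbabilityTheory.IsGaussian.map_neg_eq_self {E : Type*} [NormedAddCommGroup E]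
    [NormedSpace ℝ E] [CompleteSpace E] [SecondCountableTopology E] [MeasurableSpace E]
    [BorelSpace E] {μ : Measure E} [IsGaussian μ] (hμ : ∫ x, x ∂μ = 0) :
    μ.map (fun x ↦ -x) = μ := by
  have hneg : μ.map (-ContinuousLinearMap.id ℝ E) = μ := by
    apply Measure.ext_of_charFunDual
    ext L
    rw [charFunDual_map, IsGaussian.charFunDual_eq_of_integral_eq_zero hμ,
      IsGaussian.charFunDual_eq_of_integral_eq_zero hμ]
    have hcomp : ⇑(L ∘L (-ContinuousLinearMap.id ℝ E)) = -⇑L := by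
      ext x
      simp
    rw [hcomp, variance_neg]
  exact hneg

/-- Odd functions integrate to zero against a centered Gaussian measure. -/
lemma ProbabilityTheory.IsGaussian.integral_eq_zero_of_odd {E : Type*} [NormedAddCommGroup E]
    [NormedSpace ℝ E] [CompleteSpace E] [SecondCountableTopology E] [MeasurableSpace E]
    [BorelSpace E] {μ : Measure E} [IsGaussian μ] (hμ : ∫ x, x ∂μ = 0) {g : E → ℝ}
    (hg : Function.Odd g) : ∫ x, g x ∂μ = 0 := by
  have h : ∫ x, g x ∂μ = ∫ x, g (-x) ∂μ := by
    conv_lhs => rw [← IsGaussian.map_neg_eq_self hμ]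
    exact integral_map_equiv (MeasurableEquiv.neg E) g
  simp_rw [hg _, integral_neg] at h
  linarith

/-- The product of two functions with finite moments of all orders has finite moments of all
orders. -/
lemma MeasureTheory.MemLp.mul_of_forall_ne_top {Ω : Type*} [MeasurableSpace Ω] {μ : Measure Ω}
    {g h : Ω → ℝ} (hg : ∀ p : ℝ≥0∞, p ≠ ∞ → MemLp g p μ) (hh : ∀ p : ℝ≥0∞, p ≠ ∞ → MemLp h p μ)
    (p : ℝ≥0∞) (hp : p ≠ ∞) : MemLp (fun x ↦ g x * h x) p μ := by
  have : ENNReal.HolderTriple (2 * p) (2 * p) p := ⟨by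
    rw [ENNReal.mul_inv (by simp) (by simp), ← add_mul, ENNReal.inv_two_add_inv_two, one_mul]⟩
  have hp2 : 2 * p ≠ ∞ := ENNReal.mul_ne_top (by simp) hp
  exact (hh _ hp2).mul' (hg _ hp2)

/-- A joint cumulant containing two singlets equals the cumulant in which the two
singlets are replaced by one doublet: the fourth joint cumulant of `Xₐ, X_b` and the
centered doublets `Ỹ_{cd}, Ỹ_{ef}` equals the third joint cumulant of
`Ỹ_{ab}, Ỹ_{cd}, Ỹ_{ef}`. -/
theorem fourth_cumulant_two_singlets_eq_third (n : ℕ)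
    (μ : Measure (EuclideanSpace ℝ (Fin n))) (hμ : IsCenteredGaussian μ)
    (a b c d e f : Fin n) :
    (∫ x, x a * x b * (x c * x d - ∫ y, y c * y d ∂μ) *
          (x e * x f - ∫ y, y e * y f ∂μ) ∂μ) -
      (∫ x, x a * x b ∂μ) *
        (∫ x, (x c * x d - ∫ y, y c * y d ∂μ) * (x e * x f - ∫ y, y e * y f ∂μ) ∂μ) -
      (∫ x, x a * (x c * x d - ∫ y, y c * y d ∂μ) ∂μ) *
        (∫ x, x b * (x e * x f - ∫ y, y e * y f ∂μ) ∂μ) -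
      (∫ x, x a * (x e * x f - ∫ y, y e * y f ∂μ) ∂μ) *
        (∫ x, x b * (x c * x d - ∫ y, y c * y d ∂μ) ∂μ) =
    (∫ x, (x a * x b - ∫ y, y a * y b ∂μ) * (x c * x d - ∫ y, y c * y d ∂μ) *
        (x e * x f - ∫ y, y e * y f ∂μ) ∂μ) := by
  obtain ⟨_, hgauss, hmean⟩ := hμ
  have : IsGaussian μ := isGaussian_of_map_eq_gaussianReal hgauss
  have hcoord (i : Fin n) (p : ℝ≥0∞) (hp : p ≠ ∞) : MemLp (fun x ↦ x i) p μ :=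
    IsGaussian.memLp_dual μ (EuclideanSpace.proj i) p hp
  have hprod (i j : Fin n) := MemLp.mul_of_forall_ne_top (hcoord i) (hcoord j)
  have hdoublet (i j : Fin n) (p : ℝ≥0∞) (hp : p ≠ ∞) :
      MemLp (fun x ↦ x i * x j - ∫ y, y i * y j ∂μ) p μ :=
    (hprod i j p hp).sub (memLp_const _)
  have hpair := MemLp.mul_of_forall_ne_top (hdoublet c d) (hdoublet e f)
  have hquad := MemLp.mul_of_forall_ne_top (hprod a b) hpair
  have hodd (i j k : Fin n) : ∫ x, x i * (x j * x k - ∫ y, y j * y k ∂μ) ∂μ = 0 :=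
    IsGaussian.integral_eq_zero_of_odd hmean fun x ↦ by simp
  have hexpand (x : EuclideanSpace ℝ (Fin n)) :
      (x a * x b - ∫ y, y a * y b ∂μ) * (x c * x d - ∫ y, y c * y d ∂μ) *
          (x e * x f - ∫ y, y e * y f ∂μ) =
        x a * x b * ((x c * x d - ∫ y, y c * y d ∂μ) * (x e * x f - ∫ y, y e * y f ∂μ)) -
          (∫ y, y a * y b ∂μ) *
            ((x c * x d - ∫ y, y c * y d ∂μ) * (x e * x f - ∫ y, y e * y f ∂μ)) := by
    ring
  simp only [hexpand]
  rw [integral_sub (memLp_one_iff_integrable.mp (hquad 1 (by simp)))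
    ((memLp_one_iff_integrable.mp (hpair 1 (by simp))).const_mul _), integral_const_mul]
  simp only [hodd, mul_zero, sub_zero, mul_assoc]
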